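/- arXiv:2302.06892 — 2 statements merged into one kernel-verified Lean document; each statement's English description precedes it below -/
import Mathlib

section
/- Let R be a commutative ring with unit of characteristic zero and let S = ℤ[I⁻¹] be its HR-characteristic group, where I is the set of primes p such that R is uniquely p-divisible. Then for any group G the following are equivalent: (1) G is strongly R-perfect, i.e., (Abelianization G) ⊗_ℤ R = 0 and Tor₁^ℤ(Abelianization G, R) = 0; (2) G is strongly S-perfect, i.e., (Abelianization G) ⊗_ℤ S = 0 and Tor₁^ℤ(Abelianization G, S) = 0; (3) G is S-perfect, i.e., (Abelianization G) ⊗_ℤ S = 0. -/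
open CategoryTheory

/-- The set of integers `p` that are (the images of) prime numbers such that `R` is
uniquely `p`-divisible, i.e. the map `x ↦ p • x` is a bijection of `R`. -/
def uniquelyDivisiblePrimes (R : Type*) [CommRing R] : Set ℤ :=
  (fun p : ℕ => (p : ℤ)) '' {p : ℕ | p.Prime ∧ Function.Bijective fun x : R => p • x}

/-- The `HR`-characteristic group of a ring `R` of characteristic zero: the localization
`S = ℤ[I⁻¹]` of `ℤ` at the multiplicative submonoid generated by the set `I` of primes `p`
such that `R` is uniquely `p`-divisible. -/
def characteristicGroup (R : Type*) [CommRing R] : Type _ :=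
  Localization (Submonoid.closure (uniquelyDivisiblePrimes R))

noncomputable instance (R : Type*) [CommRing R] : CommRing (characteristicGroup R) :=
  inferInstanceAs (CommRing (Localization _))

/-- `Tor₁^ℤ(H₁(G;ℤ), T)`: the first `Tor` group over `ℤ` of the abelianization of `G`
(that is, `H₁(G;ℤ)`) against the `ℤ`-module `T`. -/
noncomputable def torH1 (G : Type) [Group G] (T : Type) [AddCommGroup T] [Module ℤ T] :
    ModuleCat ℤ :=
  ((Tor (ModuleCat ℤ) 1).obj (ModuleCat.of ℤ (Additive (Abelianization G)))).obj
    (ModuleCat.of ℤ T)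


lemma tor_presentation (Z : Type) [CommRing Z] (A T : Type) [AddCommGroup A] [Module Z A] [AddCommGroup T] [Module Z T]
    (h : Subsingleton (((Tor (ModuleCat Z) 1).obj (ModuleCat.of Z A)).obj (ModuleCat.of Z T))) :
    ∃ (F : ModuleCat.{0} Z) (_ : Module.Projective Z F) (e : F →ₗ[Z] T),
      Function.Surjective e ∧ Function.Injective (LinearMap.lTensor A e.ker.subtype) := by
  let P := projectiveResolution (ModuleCat.of Z T)
  have hex : Function.Exact (LinearMap.lTensor A (P.complex.d 2 1).hom)
      (LinearMap.lTensor A (P.complex.d 1 0).hom) := by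
    rw [← ModuleCat.isZero_iff_subsingleton] at h
    have h2 := (Iso.isZero_iff (P.isoLeftDerivedObj
      ((MonoidalCategory.tensoringLeft _).obj (ModuleCat.of Z A)) 1)).1 h
    change Limits.IsZero (HomologicalComplex.homology _ 1) at h2
    rw [← HomologicalComplex.exactAt_iff_isZero_homology,
      HomologicalComplex.exactAt_iff' _ 2 1 0 (by simp) (by simp),
      ShortComplex.ShortExact.moduleCat_exact_iff_function_exact] at h2
    exact h2
  have e0 := (ShortComplex.ShortExact.moduleCat_exact_iff_function_exact _).1 P.exact₀
  have e1 := (ShortComplex.ShortExact.moduleCat_exact_iff_function_exact _).1 (P.exact_succ 0)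
  have hs : Function.Surjective (P.π.f 0).hom :=
    (ModuleCat.epi_iff_surjective (P.π.f 0)).1 inferInstance
  let e : P.complex.X 0 →ₗ[Z] T := (P.π.f 0).hom
  refine ⟨P.complex.X 0, ?_, e, hs, ?_⟩
  · exact (IsProjective.iff_projective _).2 (P.projective 0)
  · let d : P.complex.X 1 →ₗ[Z] e.ker := LinearMap.codRestrict e.ker (P.complex.d 1 0).hom
      (fun x => (e0 _).2 ⟨x, rfl⟩)
    have hd : e.ker.subtype ∘ₗ d = (P.complex.d 1 0).hom := rfl
    have ds : Function.Surjective d := by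
      rintro ⟨y, hy⟩
      obtain ⟨x, hx⟩ := (e0 y).1 hy
      exact ⟨x, Subtype.ext hx⟩
    have dex : Function.Exact (P.complex.d 2 1).hom d := by
      intro x
      rw [← e1 x]
      exact Subtype.ext_iff
    have tex := lTensor_exact A dex ds
    have ts := LinearMap.lTensor_surjective A ds
    rw [injective_iff_map_eq_zero]
    intro y hy
    obtain ⟨x, rfl⟩ := ts y
    rw [← LinearMap.comp_apply, ← LinearMap.lTensor_comp, hd] at hy
    exact (tex x).2 ((hex x).1 hy)

lemma tensor_killed (Z : Type) [CommRing Z] (A T : Type) [AddCommGroup A] [Module Z A] [AddCommGroup T] [Module Z T]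
    (M : Submonoid Z) (hA : ∀ a : A, ∃ s ∈ M, s • a = 0) (x : TensorProduct Z A T) :
    ∃ s ∈ M, s • x = 0 := by
  induction x with
  | zero => exact ⟨1, M.one_mem, smul_zero _⟩
  | tmul a t =>
    obtain ⟨s, hs, h⟩ := hA a
    exact ⟨s, hs, by rw [TensorProduct.smul_tmul', h, TensorProduct.zero_tmul]⟩
  | add x y hx hy =>
    obtain ⟨s, hs, h⟩ := hx
    obtain ⟨t, ht, h'⟩ := hy
    refine ⟨s * t, M.mul_mem hs ht, ?_⟩
    rw [smul_add, mul_comm, mul_smul, h, mul_comm, mul_smul, h']; simp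

lemma tensor_zero (Z : Type) [CommRing Z] (A T : Type) [AddCommGroup A] [Module Z A] [AddCommGroup T] [Module Z T]
    (M : Submonoid Z) (hA : ∀ a : A, ∃ s ∈ M, s • a = 0)
    (hT : ∀ s ∈ M, Function.Bijective (fun t : T => s • t)) :
    Subsingleton (TensorProduct Z A T) := by
  refine subsingleton_of_forall_eq 0 fun x => ?_
  induction x with
  | zero => rfl
  | tmul a t =>
    obtain ⟨s, hs, h⟩ := hA a
    obtain ⟨t, rfl⟩ := (hT s hs).2 t
    dsimp
    rw [← TensorProduct.smul_tmul, h, TensorProduct.zero_tmul]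
  | add x y hx hy => rw [hx, hy, add_zero]

lemma tor_killed (Z : Type) [CommRing Z] (A T : Type) [AddCommGroup A] [Module Z A]
    [AddCommGroup T] [Module Z T]
    (M : Submonoid Z) (hA : ∀ a : A, ∃ s ∈ M, s • a = 0)
    (x : ((Tor (ModuleCat Z) 1).obj (ModuleCat.of Z A)).obj (ModuleCat.of Z T)) :
    ∃ s ∈ M, s • x = 0 := by
  let P := projectiveResolution (ModuleCat.of Z T)
  let L := (((MonoidalCategory.tensoringLeft _).obj (ModuleCat.of Z A)).mapHomologicalComplex
    (ComplexShape.down ℕ)).obj P.complex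
  let i : ((Tor (ModuleCat Z) 1).obj (ModuleCat.of Z A)).obj (ModuleCat.of Z T) ≅ L.homology 1 :=
    P.isoLeftDerivedObj ((MonoidalCategory.tensoringLeft _).obj (ModuleCat.of Z A)) 1
  obtain ⟨z, hz⟩ := (ModuleCat.epi_iff_surjective (L.homologyπ 1)).1 inferInstance (i.hom x)
  obtain ⟨s, hs, h⟩ := tensor_killed Z A (P.complex.X 1) M hA (L.iCycles 1 z)
  refine ⟨s, hs, ?_⟩
  have h1 : s • z = 0 := by
    apply (ModuleCat.mono_iff_injective (L.iCycles 1)).1 inferInstance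
    rw [map_zero]
    exact (map_smul (L.iCycles 1).hom s z).trans h
  apply (ModuleCat.mono_iff_injective i.hom).1 inferInstance
  have h3 : i.hom (s • x) = s • i.hom x := map_smul i.hom.hom s x
  have h4 : L.homologyπ 1 (s • z) = s • L.homologyπ 1 z := map_smul (L.homologyπ 1).hom s z
  rw [h3, ← hz, ← h4, h1, map_zero, map_zero]

lemma tor_zero (A T : Type) [AddCommGroup A] [instA : Module ℤ A] [AddCommGroup T]
    [instT : Module ℤ T]
    (M : Submonoid ℤ) (hA : ∀ a : A, ∃ s ∈ M, s • a = 0)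
    (hT : ∀ s ∈ M, Function.Bijective (fun t : T => s • t)) :
    Subsingleton (((Tor (ModuleCat ℤ) 1).obj (ModuleCat.of ℤ A)).obj (ModuleCat.of ℤ T)) := by
  obtain rfl : instA = AddCommGroup.toIntModule A := Subsingleton.elim _ _
  obtain rfl : instT = AddCommGroup.toIntModule T := Subsingleton.elim _ _
  refine subsingleton_of_forall_eq 0 fun x => ?_
  obtain ⟨s, hs, h⟩ := tor_killed ℤ A T M hA x
  let f : ModuleCat.of ℤ T ⟶ ModuleCat.of ℤ T := s • 𝟙 (ModuleCat.of ℤ T)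
  have : IsIso f := by
    rw [ConcreteCategory.isIso_iff_bijective]
    exact hT s hs
  let g := ((Tor (ModuleCat ℤ) 1).obj (ModuleCat.of ℤ A)).map f
  have hg : g = s • 𝟙 _ := by
    dsimp only [g, f]
    let P := projectiveResolution (ModuleCat.of ℤ T)
    have := Functor.leftDerived_map_eq
      ((MonoidalCategory.tensoringLeft (ModuleCat ℤ)).obj (ModuleCat.of ℤ A)) 1 f
      (P := P) (Q := P) (s • 𝟙 P.complex) (by
        rw [Functor.map_zsmul, CategoryTheory.Functor.map_id, Preadditive.zsmul_comp,
          Preadditive.comp_zsmul, Category.id_comp, Category.comp_id])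
    refine this.trans ?_
    rw [Functor.map_zsmul, CategoryTheory.Functor.map_id, Preadditive.zsmul_comp,
          Preadditive.comp_zsmul]
    refine congrArg (fun y => s • y) ?_
    refine (congrArg (fun y => _ ≫ y) (Category.id_comp _)).trans ?_
    exact Iso.hom_inv_id _
  apply (ModuleCat.mono_iff_injective g).1 inferInstance
  rw [hg, map_zero, ← h]
  change (s • 𝟙 (((Tor (ModuleCat ℤ) 1).obj (ModuleCat.of ℤ A)).obj (ModuleCat.of ℤ T))).hom x = _
  rw [ModuleCat.hom_zsmul]
  exact (int_smul_eq_zsmul (ModuleCat.isModule _) s x).symm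

open TensorProduct in
lemma quot_mod (Z : Type) [CommRing Z] (p : Z) (X : Type) [AddCommGroup X] [Module Z X] (x : X)
    (h : (1 : Z ⧸ Ideal.span {p}) ⊗ₜ[Z] x = 0) : ∃ y, x = p • y := by
  have h2 := congrArg (quotTensorEquivQuotSMul X (Ideal.span {p})) h
  have h3 : (1 : Z ⧸ Ideal.span {p}) = Ideal.Quotient.mk _ 1 := rfl
  rw [h3, quotTensorEquivQuotSMul_mk_tmul, map_zero, one_smul,
      Submodule.Quotient.mk_eq_zero, Submodule.ideal_span_singleton_smul,
      Submodule.mem_smul_pointwise_iff_exists] at h2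
  obtain ⟨y, -, hy⟩ := h2
  exact ⟨y, hy.symm⟩

open TensorProduct in
lemma quot_surj (Z : Type) [CommRing Z] (p : Z) (X : Type) [AddCommGroup X] [Module Z X]
    (x : (Z ⧸ Ideal.span {p}) ⊗[Z] X) : ∃ y : X, x = 1 ⊗ₜ y := by
  induction x with
  | zero => exact ⟨0, by simp⟩
  | tmul c y =>
    obtain ⟨c, rfl⟩ := Ideal.Quotient.mk_surjective c
    refine ⟨c • y, ?_⟩
    rw [← TensorProduct.smul_tmul]
    congr 1
    rw [Algebra.smul_def, mul_one]; rfl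
  | add x y hx hy =>
    obtain ⟨x, rfl⟩ := hx
    obtain ⟨y, rfl⟩ := hy
    exact ⟨x + y, by rw [tmul_add]⟩

open TensorProduct in
lemma exists_functional (Z : Type) [CommRing Z] [IsDomain Z] [IsPrincipalIdealRing Z]
    (B : Type) [AddCommGroup B] [Module Z B] (p : Z) (hp : Irreducible p)
    (hB : ∀ b : B, p • b = 0) (b : B) (hb : b ≠ 0) :
    ∃ (k : Type) (_ : AddCommGroup k) (_ : Module Z k) (r : B →ₗ[Z] k),
      (∀ (X : Type) [AddCommGroup X] [Module Z X] (x : X), r b ⊗ₜ[Z] x = 0 → ∃ y, x = p • y) ∧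
      (∀ (X : Type) [AddCommGroup X] [Module Z X] (x : k ⊗[Z] X), ∃ y : X, x = r b ⊗ₜ y) := by
  have hmax : (Ideal.span {p}).IsMaximal := PrincipalIdealRing.isMaximal_of_irreducible hp
  obtain ⟨r, hr⟩ : ∃ r : B →ₗ[Z] (Z ⧸ Ideal.span {p}), r b = 1 := by
    let fk : Field (Z ⧸ Ideal.span {p}) := Ideal.Quotient.field _
    let mk : Module (Z ⧸ Ideal.span {p}) B := Module.IsTorsionBySet.module
      ((Module.isTorsionBySet_span_singleton_iff p).2 (fun x => hB x))
    have hst : IsScalarTower Z (Z ⧸ Ideal.span {p}) B := Module.IsTorsionBySet.isScalarTower _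
    obtain ⟨g, hg⟩ := Module.Projective.exists_dual_eq_one (Z ⧸ Ideal.span {p}) hb
    exact ⟨g.restrictScalars Z, hg⟩
  refine ⟨Z ⧸ Ideal.span {p}, inferInstance, inferInstance, r, ?_, ?_⟩
  · intro X _ _ x
    rw [hr]
    exact quot_mod Z p X x
  · intro X _ _ x
    rw [hr]
    exact quot_surj Z p X x

open TensorProduct in
lemma key_p (Z : Type) [CommRing Z] [IsDomain Z] [IsPrincipalIdealRing Z]
    (A F T : Type) [AddCommGroup A] [Module Z A] [AddCommGroup T] [Module Z T]
    [AddCommGroup F] [Module Z F] [Module.Projective Z F] (e : F →ₗ[Z] T)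
    (he : Function.Surjective e) (hA : Subsingleton (TensorProduct Z A T))
    (hi : Function.Injective (LinearMap.lTensor A e.ker.subtype))
    (p : Z) (hp : Irreducible p) (a : A) (ha : a ≠ 0) (hpa : p • a = 0) :
    Function.Bijective (fun t : T => p • t) := by
  -- the p-torsion of A and a functional on it
  let B := Submodule.torsionBy Z A p
  have hB : ∀ b : B, p • b = 0 := fun b => Submodule.smul_torsionBy p b
  let b : B := ⟨a, hpa⟩
  have hb : b ≠ 0 := fun h => ha (congrArg Subtype.val h)
  obtain ⟨k, _, _, r, mod, surjk⟩ := exists_functional Z B p hp hB b hb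
  have hpB (X : Type) [AddCommGroup X] [Module Z X] (f : X) : b ⊗ₜ[Z] (p • f) = 0 := by
    rw [← TensorProduct.smul_tmul, hB, zero_tmul]
  have exB : Function.Exact B.subtype (p • (LinearMap.id : A →ₗ[Z] A)) := by
    intro x
    simp [B]
  have hsT : Function.Surjective (LinearMap.lTensor A e.ker.subtype) := by
    have := lTensor_exact A (LinearMap.exact_subtype_ker_map e) he
    intro y
    exact (this y).1 (Subsingleton.elim _ _)
  -- functional on tensor products
  let φ (X : Type) [AddCommGroup X] [Module Z X] : B ⊗[Z] X →ₗ[Z] k ⊗[Z] X := LinearMap.rTensor X r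
  have hφ (X : Type) [AddCommGroup X] [Module Z X] (x : X) : φ X (b ⊗ₜ x) = r b ⊗ₜ x := by
    simp [φ]
  have injB (X : Type) [AddCommGroup X] [Module Z X] [Module.Flat Z X] :
      Function.Injective (LinearMap.rTensor X B.subtype) :=
    Module.Flat.rTensor_preserves_injective_linearMap _ B.injective_subtype
  constructor
  · intro t t' htt
    obtain ⟨f, hf⟩ := he (t - t')
    have hpf : p • f ∈ e.ker := by
      rw [LinearMap.mem_ker, map_smul, hf, smul_sub, sub_eq_zero]
      exact htt
    have h1 : b ⊗ₜ[Z] (⟨p • f, hpf⟩ : e.ker) = 0 := by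
      apply injB
      apply hi
      rw [map_zero, map_zero, LinearMap.rTensor_tmul, LinearMap.lTensor_tmul]
      change a ⊗ₜ[Z] (p • f) = 0
      rw [← TensorProduct.smul_tmul, hpa, zero_tmul]
    have h2 := congrArg (φ _) h1
    rw [map_zero, hφ] at h2
    obtain ⟨y, hy⟩ := mod _ _ h2
    have h3 : p • f = p • (y : F) := congrArg Subtype.val hy
    have htf : Module.IsTorsionFree Z F := inferInstance
    have h4 : f = y := smul_right_injective F hp.ne_zero h3
    rw [← sub_eq_zero, ← hf, h4]
    exact y.2
  · intro t
    obtain ⟨f, rfl⟩ := he t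
    obtain ⟨x, hx⟩ := hsT (a ⊗ₜ f)
    have hx0 : LinearMap.rTensor e.ker (p • (LinearMap.id : A →ₗ[Z] A)) x = 0 := by
      rw [LinearMap.rTensor_smul, LinearMap.rTensor_id]
      apply hi
      rw [map_zero, LinearMap.smul_apply, map_smul, LinearMap.id_apply, hx, smul_tmul', hpa,
        zero_tmul]
    obtain ⟨x', rfl⟩ := (Module.Flat.rTensor_exact e.ker exB x).1 hx0
    have h1 : LinearMap.lTensor B e.ker.subtype x' = b ⊗ₜ f := by
      apply injB F
      rw [← LinearMap.comp_apply, LinearMap.rTensor_comp_lTensor,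
        ← LinearMap.lTensor_comp_rTensor, LinearMap.comp_apply, hx]
      rfl
    obtain ⟨y, hy⟩ := surjk _ (φ _ x')
    have h2 := congrArg (φ F) h1
    rw [← LinearMap.comp_apply, LinearMap.rTensor_comp_lTensor,
        ← LinearMap.lTensor_comp_rTensor, LinearMap.comp_apply, hφ] at h2
    change LinearMap.lTensor k e.ker.subtype (φ _ x') = _ at h2
    rw [hy, LinearMap.lTensor_tmul, ← sub_eq_zero, ← tmul_sub] at h2
    obtain ⟨w, hw⟩ := mod F _ h2
    refine ⟨e (-w), ?_⟩
    have h3 := congrArg e hw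
    rw [map_sub, map_smul, Submodule.subtype_apply, LinearMap.mem_ker.1 y.2, zero_sub] at h3
    simp [← h3]

lemma finite_order (A T : Type) [AddCommGroup A] [instA : Module ℤ A] [CommRing T] [CharP T 0]
    [instT : Module ℤ T] (h : Subsingleton (TensorProduct ℤ A T)) (a : A) :
    ∃ n : ℕ, n ≠ 0 ∧ n • a = 0 := by
  obtain rfl : instA = AddCommGroup.toIntModule A := Subsingleton.elim _ _
  obtain rfl : instT = AddCommGroup.toIntModule T := Subsingleton.elim _ _
  by_contra! hn
  have hQ : Module.Baer ℤ ℚ := Module.Baer.of_divisible ℚ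
  let g : ℤ →ₗ[ℤ] ℚ := (Int.castAddHom ℚ).toIntLinearMap
  have : CharZero T := CharP.charP_to_charZero T
  obtain ⟨u, hu⟩ := hQ.extension_property (LinearMap.toSpanSingleton ℤ A a) (by
    rw [injective_iff_map_eq_zero]
    intro m hm
    rw [LinearMap.toSpanSingleton_apply] at hm
    by_contra hm0
    apply hn m.natAbs (by simpa using hm0)
    rw [← natCast_zsmul]
    rcases Int.natAbs_eq m with h | h
    · rw [← h]; exact hm
    · rw [← neg_eq_zero, ← neg_zsmul, ← h]; exact hm) g
  obtain ⟨v, hv⟩ := hQ.extension_property (LinearMap.toSpanSingleton ℤ T 1) (by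
    rw [injective_iff_map_eq_zero]
    intro m hm
    simpa using hm) g
  have hu1 : u a = 1 := by simpa [g] using LinearMap.congr_fun hu 1
  have hv1 : v 1 = 1 := by simpa [g] using LinearMap.congr_fun hv 1
  have h0 : TensorProduct.map u v (TensorProduct.tmul ℤ a 1) = TensorProduct.map u v 0 :=
    congrArg _ (Subsingleton.elim _ _)
  have h1 := congrArg (LinearMap.mul' ℤ ℚ) h0
  simp [hu1, hv1] at h1

lemma killed_of_loc' (Z : Type) [CommRing Z] (M : Submonoid Z) (L : Type) [CommRing L] [Algebra Z L]
    [IsLocalization M L] (A : Type) [AddCommGroup A]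
    [Module Z A] (h : Subsingleton (TensorProduct Z A L)) (a : A) :
    ∃ s ∈ M, s • a = 0 := by
  have : IsLocalizedModule M (TensorProduct.mk Z L A 1) :=
    (isLocalizedModule_iff_isBaseChange M L _).2 (TensorProduct.isBaseChange Z A L)
  have hs : Subsingleton (TensorProduct Z L A) := (TensorProduct.comm Z L A).toEquiv.subsingleton
  have h2 : TensorProduct.mk Z L A 1 a = 0 := Subsingleton.elim _ _
  rw [IsLocalizedModule.eq_zero_iff M] at h2
  obtain ⟨s, hs⟩ := h2
  exact ⟨s, s.2, hs⟩

lemma loc_bij' (Z : Type) [CommRing Z] (M : Submonoid Z) (L : Type) [CommRing L] [Algebra Z L]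
    [IsLocalization M L] (s : Z) (hs : s ∈ M) :
    Function.Bijective (fun t : L => s • t) := by
  have h := IsLocalization.map_units L (⟨s, hs⟩ : M)
  have h2 : (fun t : L => s • t) = fun t => algebraMap Z L s * t := by
    funext t
    exact Algebra.smul_def s t
  rw [h2]
  exact IsUnit.isUnit_iff_mulLeft_bijective.1 h

lemma isLoc (R : Type) [CommRing R] :
    IsLocalization (Submonoid.closure (uniquelyDivisiblePrimes R)) (characteristicGroup R) := by
  let alg : Algebra ℤ (characteristicGroup R) := inferInstanceAs
    (Algebra ℤ (Localization (Submonoid.closure (uniquelyDivisiblePrimes R))))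
  have h : @IsLocalization ℤ _ (Submonoid.closure (uniquelyDivisiblePrimes R))
    (characteristicGroup R) _ alg := inferInstanceAs (IsLocalization _
      (Localization (Submonoid.closure (uniquelyDivisiblePrimes R))))
  have h2 : alg = Ring.toIntAlgebra _ := Subsingleton.elim _ _
  rw [h2] at h
  exact h

lemma killed_of_loc (R : Type) [CommRing R] (A : Type) [AddCommGroup A]
    (h : Subsingleton (TensorProduct ℤ A (characteristicGroup R))) (a : A) :
    ∃ s ∈ Submonoid.closure (uniquelyDivisiblePrimes R), s • a = 0 := by
  have := isLoc R
  exact killed_of_loc' ℤ _ (characteristicGroup R) A h a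

lemma loc_bij (R : Type) [CommRing R] (s : ℤ)
    (hs : s ∈ Submonoid.closure (uniquelyDivisiblePrimes R)) :
    Function.Bijective (fun t : characteristicGroup R => s • t) := by
  have := isLoc R
  exact loc_bij' ℤ _ (characteristicGroup R) s hs

lemma R_bij (R : Type) [CommRing R] (s : ℤ)
    (hs : s ∈ Submonoid.closure (uniquelyDivisiblePrimes R)) :
    Function.Bijective (fun t : R => s • t) := by
  induction hs using Submonoid.closure_induction with
  | mem x hx =>
    obtain ⟨p, ⟨-, hp⟩, rfl⟩ := hx
    simpa using hp
  | one => simpa using! Function.bijective_id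
  | mul x y _ _ hx hy =>
    have := hx.comp hy
    simpa [Function.comp_def, mul_smul] using this

lemma killed_aux (M : Submonoid ℤ) (A : Type) [AddCommGroup A]
    (H : ∀ p : ℕ, p.Prime → ∀ a : A, a ≠ 0 → p • a = 0 → (p : ℤ) ∈ M) (n : ℕ) :
    ∀ a : A, n ≠ 0 → n • a = 0 → ∃ s ∈ M, s • a = 0 := by
  induction n using Nat.strong_induction_on with
  | _ n ih =>
  intro a hn hna
  by_cases h1 : n = 1
  · subst h1
    exact ⟨1, M.one_mem, by simpa using hna⟩
  obtain ⟨p, hp, m, rfl⟩ := Nat.exists_prime_and_dvd h1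
  have hm : m ≠ 0 := by rintro rfl; simp at hn
  have hlt : m < p * m := by nlinarith [hp.two_le, Nat.pos_of_ne_zero hm]
  by_cases hma : m • a = 0
  · exact ih m hlt a hm hma
  · have hpM := H p hp (m • a) hma (by rw [← mul_smul]; exact hna)
    obtain ⟨s, hs, hsa⟩ := ih m hlt (p • a) hm (by rw [← mul_smul, mul_comm]; exact hna)
    refine ⟨s * p, M.mul_mem hs hpM, ?_⟩
    rw [mul_smul, natCast_zsmul, hsa]

lemma killed_of_R (R : Type) [CommRing R] [CharP R 0] (A : Type) [AddCommGroup A]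
    [instA : Module ℤ A]
    [instR : Module ℤ R] (h : Subsingleton (TensorProduct ℤ A R))
    (h' : Subsingleton (((Tor (ModuleCat ℤ) 1).obj (ModuleCat.of ℤ A)).obj (ModuleCat.of ℤ R)))
    (a : A) :
    ∃ s ∈ Submonoid.closure (uniquelyDivisiblePrimes R), s • a = 0 := by
  obtain rfl : instA = AddCommGroup.toIntModule A := Subsingleton.elim _ _
  obtain ⟨n, hn, hna⟩ := finite_order A R h a
  obtain ⟨F, _, e, he, hi⟩ := tor_presentation ℤ A R h'
  refine killed_aux _ A (fun p hp a ha hpa => ?_) n a hn hna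
  apply Submonoid.subset_closure
  refine ⟨p, ⟨hp, ?_⟩, rfl⟩
  have := key_p ℤ A F R e he h hi p (Nat.prime_iff_prime_int.1 hp).irreducible a ha
    (by rw [natCast_zsmul]; exact hpa)
  convert this using 2 with t
  rw [Nat.cast_smul_eq_nsmul]

/-- Let `R` be a commutative ring of characteristic zero and `S` its `HR`-characteristic
group.  For a group `G` the following are equivalent: (1) `G` is strongly `R`-perfect;
(2) `G` is strongly `S`-perfect; (3) `G` is `S`-perfect. -/
theorem stronglyRPerfect_tfae (R : Type) [CommRing R] [CharP R 0] (G : Type) [Group G] :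
    List.TFAE
      [Subsingleton (TensorProduct ℤ (Additive (Abelianization G)) R) ∧
          Subsingleton (torH1 G R),
        Subsingleton (TensorProduct ℤ (Additive (Abelianization G)) (characteristicGroup R)) ∧
          Subsingleton (torH1 G (characteristicGroup R)),
        Subsingleton (TensorProduct ℤ (Additive (Abelianization G)) (characteristicGroup R))] := by
  tfae_have 1 → 3 := fun ⟨h, h'⟩ =>
    tensor_zero ℤ _ _ _ (killed_of_R R _ h h') (fun s hs => loc_bij R s hs)
  tfae_have 3 → 2 := fun h =>
    ⟨h, tor_zero _ _ _ (killed_of_loc R _ h) (fun s hs => loc_bij R s hs)⟩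
  tfae_have 2 → 1 := fun ⟨h, _⟩ =>
    ⟨tensor_zero ℤ _ _ _ (killed_of_loc R _ h) (fun s hs => R_bij R s hs),
      tor_zero _ _ _ (killed_of_loc R _ h) (fun s hs => R_bij R s hs)⟩
  tfae_finish
end

section
/- Let p be a prime and let R = ℚ × ℤ/p, a commutative ring of characteristic zero, whose HR-characteristic group is S = ℤ_(p), the localization of ℤ at the prime ideal (p). Let A be the Prüfer p-group, realized as the quotient abelian group ℤ[1/p]/ℤ (the localization of ℤ away from p modulo the image of ℤ). Then A is R-perfect but not S-perfect: A ⊗_ℤ R = 0, while A ⊗_ℤ ℤ_(p) ≠ 0. Consequently A is R-perfect but not strongly R-perfect. -/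
/-- The Prüfer `p`-group, realized as the quotient abelian group `ℤ[1/p]/ℤ`, i.e. the
additive group of the localization of `ℤ` away from `p`, modulo the image of `ℤ`. -/
def PruferGroup (p : ℕ) : Type :=
  Localization.Away (p : ℤ) ⧸ (Int.castAddHom (Localization.Away (p : ℤ))).range

instance (p : ℕ) : AddCommGroup (PruferGroup p) :=
  inferInstanceAs (AddCommGroup (_ ⧸ _))

/-- The quotient map `ℤ[1/p] → ℤ[1/p]/ℤ`. -/
def pruferMk (p : ℕ) : Localization.Away (p : ℤ) →+ PruferGroup p :=
  QuotientAddGroup.mk' (Int.castAddHom (Localization.Away (p : ℤ))).range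

lemma pruferMk_surj (p : ℕ) : Function.Surjective (pruferMk p) :=
  QuotientAddGroup.mk'_surjective _

lemma pruferMk_eq_zero (p : ℕ) (x : Localization.Away (p : ℤ)) :
    pruferMk p x = 0 ↔ ∃ n : ℤ, (n : Localization.Away (p : ℤ)) = x := by
  have h : pruferMk p x = 0 ↔ x ∈ (Int.castAddHom (Localization.Away (p : ℤ))).range :=
    QuotientAddGroup.eq_zero_iff x
  rw [h]
  exact AddMonoidHom.mem_range

lemma prufer_exists_inv (p : ℕ) : ∃ u : Localization.Away (p : ℤ), (p : ℤ) * u = 1 := by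
  have h := IsLocalization.Away.algebraMap_isUnit (S := Localization.Away (p : ℤ)) (p : ℤ)
  obtain ⟨u, hu⟩ := h.exists_right_inv
  exact ⟨u, by simpa using hu⟩

lemma prufer_div (p : ℕ) (a : PruferGroup p) : ∃ b : PruferGroup p, (p : ℤ) • b = a := by
  obtain ⟨x, rfl⟩ := pruferMk_surj p a
  obtain ⟨u, hu⟩ := prufer_exists_inv p
  refine ⟨pruferMk p (u * x), ?_⟩
  rw [← map_zsmul, zsmul_eq_mul, ← mul_assoc, hu, one_mul]

lemma prufer_torsion (p : ℕ) (a : PruferGroup p) : ∃ n : ℕ, ((p : ℤ) ^ n) • a = 0 := by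
  obtain ⟨x, rfl⟩ := pruferMk_surj p a
  obtain ⟨n, m, h⟩ := IsLocalization.Away.surj (p : ℤ) x
  refine ⟨n, ?_⟩
  rw [← map_zsmul, pruferMk_eq_zero]
  refine ⟨m, ?_⟩
  simp only [zsmul_eq_mul]
  simp only [eq_intCast] at h
  push_cast at h ⊢
  rw [← h, mul_comm]

lemma prufer_elt (p : ℕ) (hp : p.Prime) : ∃ a : PruferGroup p,
    ∀ s : ℤ, s • a = 0 → (p : ℤ) ∣ s := by
  obtain ⟨u, hu⟩ := prufer_exists_inv p
  refine ⟨pruferMk p u, fun s hs => ?_⟩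
  rw [← map_zsmul, pruferMk_eq_zero] at hs
  obtain ⟨n, hn⟩ := hs
  have hinj : Function.Injective (algebraMap ℤ (Localization.Away (p : ℤ))) :=
    IsLocalization.injective _ (powers_le_nonZeroDivisors_of_noZeroDivisors
      (x := (p : ℤ)) (by exact_mod_cast hp.ne_zero))
  refine ⟨n, hinj ?_⟩
  simp only [eq_intCast]
  rw [Int.cast_mul, hn, zsmul_eq_mul]
  linear_combination (-(s : Localization.Away (p : ℤ))) * hu

lemma loc_aux_gen {R : Type} [CommRing R] (M : Submonoid R) (S : Type) [CommRing S]
    [Algebra R S] [IsLocalization M S] {A : Type} [AddCommGroup A] [Module R A] (a : A)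
    (h : Subsingleton (TensorProduct R S A)) : ∃ s ∈ M, s • a = 0 := by
  have hloc : IsLocalizedModule M (TensorProduct.mk R S A 1) :=
    (isLocalizedModule_iff_isBaseChange M S _).mpr (TensorProduct.isBaseChange R A S)
  have h0 : TensorProduct.mk R S A 1 a = 0 := Subsingleton.elim _ _
  obtain ⟨s, hs⟩ := (IsLocalizedModule.eq_zero_iff M _).mp h0
  exact ⟨s, s.2, hs⟩

lemma loc_aux (M : Submonoid ℤ) (S : Type) [CommRing S] [i : Algebra ℤ S] [IsLocalization M S]
    {A : Type} [AddCommGroup A] (a : A) (h : Subsingleton (TensorProduct ℤ S A)) :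
    ∃ s ∈ M, s • a = 0 := by
  obtain rfl : i = Ring.toIntAlgebra S := Subsingleton.elim _ _
  exact loc_aux_gen M S a h

/-- Let `p` be a prime, `R = ℚ × ℤ/p` (a ring of characteristic zero whose
`HR`-characteristic group is `S = ℤ_(p)`), and `A = ℤ[1/p]/ℤ` the Prüfer `p`-group.
Then `A` is `R`-perfect but not `S`-perfect: `A ⊗_ℤ R = 0` while `A ⊗_ℤ ℤ_(p) ≠ 0`
(so `A` is `R`-perfect but not strongly `R`-perfect). -/
theorem prufer_R_perfect_not_S_perfect (p : ℕ) (hp : p.Prime) :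
    haveI : (Ideal.span {(p : ℤ)}).IsPrime :=
      (Ideal.span_singleton_prime (by exact_mod_cast hp.ne_zero)).mpr
        ((Nat.prime_iff_prime_int.mp hp))
    Subsingleton (TensorProduct ℤ (PruferGroup p) (ℚ × ZMod p)) ∧
      ¬ Subsingleton
          (TensorProduct ℤ (PruferGroup p) (Localization.AtPrime (Ideal.span {(p : ℤ)}))) := by
  have hP : (Ideal.span {(p : ℤ)}).IsPrime :=
      (Ideal.span_singleton_prime (by exact_mod_cast hp.ne_zero)).mpr
        ((Nat.prime_iff_prime_int.mp hp))
  have hp0 : (p : ℚ) ≠ 0 := by exact_mod_cast hp.ne_zero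
  constructor
  · refine subsingleton_of_forall_eq 0 fun t => ?_
    induction t with
    | zero => rfl
    | add x y hx hy => rw [hx, hy, add_zero]
    | tmul a r =>
      obtain ⟨q, z⟩ := r
      have h1 : TensorProduct.tmul ℤ a ((q, 0) : ℚ × ZMod p) = 0 := by
        obtain ⟨n, hn⟩ := prufer_torsion p a
        have : ((q, 0) : ℚ × ZMod p) = ((p : ℤ) ^ n) • ((q / (p : ℚ) ^ n, 0) : ℚ × ZMod p) := by
          ext
          · rw [Prod.smul_fst, zsmul_eq_mul]
            push_cast
            field_simp
          · simp
        rw [this, ← TensorProduct.smul_tmul, hn, TensorProduct.zero_tmul]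
      have h2 : TensorProduct.tmul ℤ a ((0, z) : ℚ × ZMod p) = 0 := by
        obtain ⟨b, rfl⟩ := prufer_div p a
        rw [TensorProduct.smul_tmul]
        have : (p : ℤ) • ((0, z) : ℚ × ZMod p) = 0 := by
          ext <;> simp
        rw [this, TensorProduct.tmul_zero]
      have : ((q, z) : ℚ × ZMod p) = (q, 0) + (0, z) := by simp
      rw [this, TensorProduct.tmul_add, h1, h2, add_zero]
  · intro hS
    obtain ⟨a, ha⟩ := prufer_elt p hp
    have h0 := (TensorProduct.comm ℤ _ _).injective.subsingleton
      (α := TensorProduct ℤ (Localization.AtPrime (Ideal.span {(p : ℤ)})) (PruferGroup p))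
    obtain ⟨s, hs, h⟩ := loc_aux (Ideal.span {(p : ℤ)}).primeCompl
      (Localization.AtPrime (Ideal.span {(p : ℤ)})) a h0
    exact hs (Ideal.mem_span_singleton.mpr (ha s h))
end
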